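/- Every monogenic inverse semigroup (an inverse semigroup generated by a single element) has the Howson property. -/

import Mathlib

inductive InvGen {S : Type*} [Mul S] [Inv S] (X : Set S) : S → Prop
  | base {x : S} : x ∈ X → InvGen X x
  | mul {a b : S} : InvGen X a → InvGen X b → InvGen X (a * b)
  | inv {a : S} : InvGen X a → InvGen X a⁻¹

def IsInvSub {S : Type*} [Mul S] [Inv S] (T : Set S) : Prop :=
  (∀ a ∈ T, ∀ b ∈ T, a * b ∈ T) ∧ ∀ a ∈ T, a⁻¹ ∈ T

def InvFG {S : Type*} [Mul S] [Inv S] (T : Set S) : Prop :=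
  ∃ X : Finset S, ↑X ⊆ T ∧ T = {s | InvGen (↑X : Set S) s}

def Howson (S : Type*) [Mul S] [Inv S] : Prop :=
  ∀ U V : Set S, IsInvSub U → IsInvSub V → InvFG U → InvFG V → InvFG (U ∩ V)
class InverseSemigroup (S : Type*) extends Semigroup S, Inv S where
  mul_inv_mul : ∀ a : S, a * a⁻¹ * a = a
  inv_invol : ∀ a : S, a⁻¹⁻¹ = a
  idem_comm : ∀ a b : S, (a * a⁻¹) * (b * b⁻¹) = (b * b⁻¹) * (a * a⁻¹)


class IMon (M : Type*) extends Monoid M, Inv M where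
  mul_inv_mul' : ∀ a : M, a * a⁻¹ * a = a
  inv_invol' : ∀ a : M, a⁻¹⁻¹ = a
  idem_comm' : ∀ a b : M, (a * a⁻¹) * (b * b⁻¹) = (b * b⁻¹) * (a * a⁻¹)

namespace IMon
variable {M : Type*} [IMon M]

theorem inv_mul_inv (a : M) : a⁻¹ * a * a⁻¹ = a⁻¹ := by
  have := mul_inv_mul' a⁻¹
  rwa [inv_invol'] at this

theorem idem_inv_mul (a b : M) : (a⁻¹ * a) * (b * b⁻¹) = (b * b⁻¹) * (a⁻¹ * a) := by
  have := idem_comm' a⁻¹ b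
  rwa [inv_invol'] at this

theorem idem_eq (e : M) (he : e * e = e) : e * e⁻¹ = e := by
  have h1 : e⁻¹ = e * e⁻¹ * (e⁻¹ * e) := by
    rw [← idem_inv_mul]
    calc e⁻¹ = e⁻¹ * (e * e) * e⁻¹ := by rw [he, inv_mul_inv]
      _ = _ := by simp only [mul_assoc]
  have h2 : e * e⁻¹ = e⁻¹ := by
    conv_rhs => rw [h1]
    conv_lhs => rw [h1]
    simp only [← mul_assoc, he]
  have h3 : e⁻¹ * e = e⁻¹ := by
    conv_rhs => rw [h1]
    conv_lhs => rw [h1]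
    simp only [mul_assoc, he]
  have h4 : e = e⁻¹ := by
    calc e = e * e⁻¹ * e := (mul_inv_mul' e).symm
      _ = e⁻¹ := by rw [h2, h3]
  rw [h2]; exact h4.symm

theorem idems_comm (e f : M) (he : e * e = e) (hf : f * f = f) : e * f = f * e := by
  have := idem_comm' e f
  rwa [idem_eq e he, idem_eq f hf] at this

theorem inv_unique (a b : M) (h1 : a * b * a = a) (h2 : b * a * b = b) : b = a⁻¹ := by
  have e1 : (a * b) * (a * b) = a * b := by rw [← mul_assoc, h1]
  have e2 : (a * a⁻¹) * (a * a⁻¹) = a * a⁻¹ := by rw [← mul_assoc, mul_inv_mul']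
  have e3 : (b * a) * (b * a) = b * a := by rw [← mul_assoc, h2]
  have e4 : (a⁻¹ * a) * (a⁻¹ * a) = a⁻¹ * a := by rw [← mul_assoc, inv_mul_inv]
  have c1 := idems_comm _ _ e1 e2
  have c2 := idems_comm _ _ e3 e4
  have d1 : a * b = a * a⁻¹ := by
    calc a * b = (a * a⁻¹) * (a * b) := by rw [← mul_assoc, mul_inv_mul']
      _ = (a * b) * (a * a⁻¹) := c1.symm
      _ = a * a⁻¹ := by rw [← mul_assoc, h1]
  have d2 : b * a = a⁻¹ * a := by
    calc b * a = (b * a) * (a⁻¹ * a) := by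
          rw [mul_assoc, ← mul_assoc a, mul_inv_mul']
      _ = (a⁻¹ * a) * (b * a) := c2
      _ = a⁻¹ * a := by rw [mul_assoc, ← mul_assoc a, h1]
  calc b = b * a * b := h2.symm
    _ = b * (a * b) := mul_assoc _ _ _
    _ = (b * a) * a⁻¹ := by rw [d1, mul_assoc]
    _ = a⁻¹ := by rw [d2, inv_mul_inv]

theorem mul_inv_rev' (a b : M) : (a * b)⁻¹ = b⁻¹ * a⁻¹ := by
  symm
  have c := idem_inv_mul a b
  apply inv_unique
  · calc a * b * (b⁻¹ * a⁻¹) * (a * b) = a * ((b * b⁻¹) * (a⁻¹ * a)) * b := by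
          simp only [mul_assoc]
      _ = (a * a⁻¹ * a) * (b * b⁻¹ * b) := by rw [← c]; simp only [mul_assoc]
      _ = a * b := by rw [mul_inv_mul', mul_inv_mul']
  · calc b⁻¹ * a⁻¹ * (a * b) * (b⁻¹ * a⁻¹) = b⁻¹ * ((a⁻¹ * a) * (b * b⁻¹)) * a⁻¹ := by
          simp only [mul_assoc]
      _ = (b⁻¹ * b * b⁻¹) * (a⁻¹ * a * a⁻¹) := by rw [c]; simp only [mul_assoc]
      _ = b⁻¹ * a⁻¹ := by rw [inv_mul_inv, inv_mul_inv]

theorem inv_one' : (1 : M)⁻¹ = 1 := (inv_unique 1 1 (by simp) (by simp)).symm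

theorem inv_pow' (a : M) (n : ℕ) : (a ^ n)⁻¹ = a⁻¹ ^ n := by
  induction n with
  | zero => simp [inv_one']
  | succ n ih => rw [pow_succ, mul_inv_rev', ih, pow_succ']

/-- signed power -/
def g (x : M) (k : ℤ) : M := if 0 ≤ k then x ^ k.toNat else x⁻¹ ^ (-k).toNat

def e (x : M) (p q : ℤ) : M :=
  x⁻¹ ^ p.toNat * x ^ p.toNat * (x ^ q.toNat * x⁻¹ ^ q.toNat)

def el (x : M) (p q k : ℤ) : M := e x p q * g x k

theorem pow_red (x : M) (n : ℕ) : x ^ n * x⁻¹ ^ n * x ^ n = x ^ n := by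
  rw [← inv_pow', mul_inv_mul']
theorem pow_red' (x : M) (n : ℕ) : x⁻¹ ^ n * x ^ n * x⁻¹ ^ n = x⁻¹ ^ n := by
  rw [← inv_pow', inv_mul_inv]
theorem pow_comm (x : M) (n m : ℕ) :
    (x⁻¹ ^ n * x ^ n) * (x ^ m * x⁻¹ ^ m) = (x ^ m * x⁻¹ ^ m) * (x⁻¹ ^ n * x ^ n) := by
  rw [← inv_pow', ← inv_pow', idem_inv_mul]

/-- absorption `x^(n+d) x^-(n+d) x^n x^-n` -/
theorem pow_abs (x : M) (n d : ℕ) :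
    (x ^ (n + d) * x⁻¹ ^ (n + d)) * (x ^ n * x⁻¹ ^ n) = x ^ (n + d) * x⁻¹ ^ (n + d) := by
  have : x⁻¹ ^ (n + d) = x⁻¹ ^ d * x⁻¹ ^ n := by rw [add_comm, pow_add]
  rw [this]
  calc _ = x ^ (n + d) * x⁻¹ ^ d * (x⁻¹ ^ n * x ^ n * x⁻¹ ^ n) := by simp only [mul_assoc]
    _ = _ := by rw [pow_red']; simp only [mul_assoc]

theorem e_swap (x : M) (p q : ℤ) : e x⁻¹ q p = e x p q := by
  unfold e
  rw [inv_invol', pow_comm]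

theorem step_aux (x : M) (m : ℕ) :
    (x⁻¹ ^ (m+1) * x ^ (m+1)) * x⁻¹ ^ m = x⁻¹ ^ (m+1) * x := by
  have h := pow_comm x 1 m
  simp only [pow_one] at h
  calc _ = x⁻¹ ^ m * ((x⁻¹ * x) * (x ^ m * x⁻¹ ^ m)) := by
        rw [pow_succ x⁻¹, pow_succ' x]; simp only [mul_assoc]
    _ = (x⁻¹ ^ m * x ^ m * x⁻¹ ^ m) * (x⁻¹ * x) := by rw [h]; simp only [mul_assoc]
    _ = _ := by rw [pow_red', pow_succ x⁻¹]; simp only [mul_assoc]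

/-- right multiplication by x -/
theorem el_mul_x (x : M) (p q k : ℤ) (hq : 0 ≤ q) (h1 : -p ≤ k) (h2 : k ≤ q) :
    el x p q k * x = el x p (max q (k+1)) (k+1) := by
  rcases lt_or_ge k 0 with hk | hk
  · rw [max_eq_left (by omega)]
    obtain ⟨m, rfl⟩ : ∃ m : ℕ, k = -((m:ℤ)+1) := ⟨(-k-1).toNat, by omega⟩
    obtain ⟨d, rfl⟩ : ∃ d : ℕ, p = ((m+1+d : ℕ) : ℤ) := ⟨(p-m-1).toNat, by push_cast; omega⟩
    have hg1 : g x (-((m:ℤ)+1)) = x⁻¹ ^ (m+1) := by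
      unfold g; rw [if_neg (by omega)]; congr 1
    have hg2 : g x (-((m:ℤ)+1)+1) = x⁻¹ ^ m := by
      unfold g
      rcases Nat.eq_zero_or_pos m with rfl | hm
      · simp
      · rw [if_neg (by omega)]; congr 1; omega
    unfold el e
    rw [hg1, hg2, pow_comm, Int.toNat_natCast]
    have ha := pow_abs x⁻¹ (m+1) d
    rw [inv_invol'] at ha
    rw [← ha]
    calc _ = x ^ q.toNat * x⁻¹ ^ q.toNat * (x⁻¹ ^ (m + 1 + d) * x ^ (m + 1 + d)) *
          ((x⁻¹ ^ (m + 1) * x ^ (m + 1) * x⁻¹ ^ (m + 1)) * x) := by simp only [mul_assoc]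
      _ = x ^ q.toNat * x⁻¹ ^ q.toNat * (x⁻¹ ^ (m + 1 + d) * x ^ (m + 1 + d)) *
          ((x⁻¹ ^ (m + 1) * x ^ (m + 1)) * x⁻¹ ^ m) := by rw [pow_red', step_aux]
      _ = _ := by simp only [mul_assoc]
  · obtain ⟨m, rfl⟩ : ∃ m : ℕ, k = m := ⟨k.toNat, by omega⟩
    obtain ⟨n, rfl⟩ : ∃ n : ℕ, q = n := ⟨q.toNat, by omega⟩
    have hg1 : g x (m:ℤ) = x ^ m := by simp [g]
    have hg2 : g x ((m:ℤ)+1) = x ^ (m+1) := by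
      unfold g; rw [if_pos (by omega)]; congr 1
    rcases lt_or_ge m n with h | h
    · rw [max_eq_left (by omega)]
      unfold el
      rw [hg1, hg2, pow_succ]; simp only [mul_assoc]
    · have : n = m := by omega
      subst this
      rw [max_eq_right (by omega)]
      unfold el e
      rw [hg1, hg2]
      have : ((n:ℤ)+1).toNat = n+1 := by omega
      rw [this, Int.toNat_natCast]
      calc _ = x⁻¹ ^ p.toNat * x ^ p.toNat * ((x ^ n * x⁻¹ ^ n * x ^ n) * x) := by
            simp only [mul_assoc]
        _ = x⁻¹ ^ p.toNat * x ^ p.toNat * (x ^ (n+1) * x⁻¹ ^ (n+1) * x ^ (n+1)) := by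
            rw [pow_red, pow_red, pow_succ]
        _ = _ := by simp only [mul_assoc]

theorem g_swap (x : M) (k : ℤ) : g x⁻¹ (-k) = g x k := by
  unfold g
  rcases lt_trichotomy k 0 with h | rfl | h
  · rw [if_pos (by omega), if_neg (by omega)]
  · simp
  · rw [if_neg (by omega), if_pos (by omega), inv_invol', neg_neg]

theorem el_swap (x : M) (p q k : ℤ) : el x⁻¹ q p (-k) = el x p q k := by
  unfold el; rw [e_swap, g_swap]

theorem el_mul_y (x : M) (p q k : ℤ) (hp : 0 ≤ p) (h1 : -p ≤ k) (h2 : k ≤ q) :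
    el x p q k * x⁻¹ = el x (max p (1-k)) q (k-1) := by
  have := el_mul_x x⁻¹ q p (-k) hp (by omega) (by omega)
  rw [el_swap] at this
  rw [this, ← el_swap x]
  congr 1 <;> omega

theorem el_mul_xn (x : M) (p q k : ℤ) (hq : 0 ≤ q) (h1 : -p ≤ k) (h2 : k ≤ q) (n : ℕ) :
    el x p q k * x ^ n = el x p (max q (k+n)) (k+n) := by
  induction n with
  | zero => simp [h2]
  | succ n ih =>
    rw [pow_succ, ← mul_assoc, ih, el_mul_x _ _ _ _ (by omega) (by omega) (by omega)]
    congr 1 <;> push_cast <;> omega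

theorem el_mul_yn (x : M) (p q k : ℤ) (hp : 0 ≤ p) (h1 : -p ≤ k) (h2 : k ≤ q) (n : ℕ) :
    el x p q k * x⁻¹ ^ n = el x (max p (n-k)) q (k-n) := by
  have := el_mul_xn x⁻¹ q p (-k) hp (by omega) (by omega) n
  rw [el_swap] at this
  rw [this, ← el_swap x]
  congr 1 <;> omega

theorem el_mul_g (x : M) (p q k k' : ℤ) (hp : 0 ≤ p) (hq : 0 ≤ q) (h1 : -p ≤ k) (h2 : k ≤ q) :
    el x p q k * g x k' = el x (max p (-k-k')) (max q (k+k')) (k+k') := by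
  unfold g
  split_ifs with h
  · rw [el_mul_xn x p q k hq h1 h2]
    congr 1 <;> omega
  · rw [el_mul_yn x p q k hp h1 h2]
    congr 1 <;> omega

theorem el_mul (x : M) (p q k p' q' k' : ℤ) (hp : 0 ≤ p) (hq : 0 ≤ q) (h1 : -p ≤ k) (h2 : k ≤ q)
    (hp' : 0 ≤ p') (hq' : 0 ≤ q') (h1' : -p' ≤ k') (h2' : k' ≤ q') :
    el x p q k * el x p' q' k' = el x (max p (p'-k)) (max q (q'+k)) (k+k') := by
  obtain ⟨p', rfl⟩ := Int.eq_ofNat_of_zero_le hp'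
  obtain ⟨q', rfl⟩ := Int.eq_ofNat_of_zero_le hq'
  conv_lhs => rw [el.eq_def x p' q' k']
  unfold e
  simp only [← mul_assoc, Int.toNat_natCast]
  rw [el_mul_yn _ _ _ _ (by omega) (by omega) (by omega),
    el_mul_xn _ _ _ _ (by omega) (by omega) (by omega),
    el_mul_xn _ _ _ _ (by omega) (by omega) (by omega),
    el_mul_yn _ _ _ _ (by omega) (by omega) (by omega),
    el_mul_g _ _ _ _ _ (by omega) (by omega) (by omega) (by omega)]
  congr 1 <;> omega

theorem el_inv (x : M) (p q k : ℤ) (hp : 0 ≤ p) (hq : 0 ≤ q) (h1 : -p ≤ k) (h2 : k ≤ q) :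
    (el x p q k)⁻¹ = el x (p+k) (q-k) (-k) := by
  symm
  apply inv_unique
  · rw [el_mul _ _ _ _ _ _ _ (by omega) (by omega) (by omega) (by omega) (by omega) (by omega) (by omega) (by omega),
      el_mul _ _ _ _ _ _ _ (by omega) (by omega) (by omega) (by omega) (by omega) (by omega) (by omega) (by omega)]
    congr 1 <;> omega
  · rw [el_mul _ _ _ _ _ _ _ (by omega) (by omega) (by omega) (by omega) (by omega) (by omega) (by omega) (by omega),
      el_mul _ _ _ _ _ _ _ (by omega) (by omega) (by omega) (by omega) (by omega) (by omega) (by omega) (by omega)]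
    congr 1 <;> omega

theorem el_x (x : M) : el x 0 1 1 = x := by
  have := pow_red x 1
  simp [el, e, g]
  simpa using this

theorem el_one (x : M) : el x 0 0 0 = 1 := by simp [el, e, g]

/-- triple representation predicate -/
def Rep (x s : M) (p q k : ℤ) : Prop := 0 ≤ p ∧ 0 ≤ q ∧ -p ≤ k ∧ k ≤ q ∧ s = el x p q k

theorem Rep.mul {x s t : M} {p q k p' q' k' : ℤ} (h : Rep x s p q k) (h' : Rep x t p' q' k') :
    Rep x (s * t) (max p (p'-k)) (max q (q'+k)) (k+k') := by
  obtain ⟨a, b, c, d, rfl⟩ := h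
  obtain ⟨a', b', c', d', rfl⟩ := h'
  refine ⟨by omega, by omega, by omega, by omega, ?_⟩
  rw [el_mul] <;> assumption

theorem Rep.inv {x s : M} {p q k : ℤ} (h : Rep x s p q k) :
    Rep x s⁻¹ (p+k) (q-k) (-k) := by
  obtain ⟨a, b, c, d, rfl⟩ := h
  refine ⟨by omega, by omega, by omega, by omega, ?_⟩
  rw [el_inv] <;> assumption

theorem Rep.cast {x s : M} {p q k p' q' k' : ℤ} (h : Rep x s p q k) (hp : p = p') (hq : q = q')
    (hk : k = k') : Rep x s p' q' k' := by subst hp hq hk; exact h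

theorem Rep.eq {x s t : M} {p q k : ℤ} (h : Rep x s p q k) (h' : Rep x t p q k) : s = t :=
  h.2.2.2.2.trans h'.2.2.2.2.symm

theorem Rep.idem {x s : M} {p q k : ℤ} (h : Rep x s p q k) :
    Rep x (s * s⁻¹) p q 0 := by
  have h1 := h.1
  have h2 := h.2.1
  have h3 := h.2.2.1
  have h4 := h.2.2.2.1
  exact (h.mul h.inv).cast (by omega) (by omega) (by omega)

theorem Rep.swap {x s : M} {p q k : ℤ} (h : Rep x s p q k) : Rep x⁻¹ s q p (-k) := by
  obtain ⟨a, b, c, d, rfl⟩ := h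
  exact ⟨b, a, by omega, by omega, (el_swap x p q k).symm⟩

theorem rep_el (x : M) {p q k : ℤ} (hp : 0 ≤ p) (hq : 0 ≤ q) (h1 : -p ≤ k) (h2 : k ≤ q) :
    Rep x (el x p q k) p q k := ⟨hp, hq, h1, h2, rfl⟩

theorem exists_rep {x s : M} (h : InvGen {x} s) : ∃ p q k, Rep x s p q k := by
  induction h with
  | base h =>
    rw [Set.mem_singleton_iff] at h
    subst h
    exact ⟨0, 1, 1, by omega, by omega, by omega, by omega, (el_x _).symm⟩
  | mul _ _ ih1 ih2 =>
    obtain ⟨p, q, k, h⟩ := ih1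
    obtain ⟨p', q', k', h'⟩ := ih2
    exact ⟨_, _, _, h.mul h'⟩
  | inv _ ih =>
    obtain ⟨p, q, k, h⟩ := ih
    exact ⟨_, _, _, h.inv⟩

/-- If `e(P,q)` is invariant under right extension then so is every larger one. -/
theorem right_collapse {x : M} {P Q Q' : ℤ} (hP : 0 ≤ P) (hQ : 0 ≤ Q) (hQ' : Q < Q')
    (h : el x P Q 0 = el x P Q' 0) (p q : ℤ) (hp : 0 ≤ p) (hq : 0 ≤ q) (hpq : P + Q ≤ p + q) :
    el x p q 0 = el x p (q+1) 0 := by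
  have r1 : Rep x (el x P Q 0) P Q 0 := rep_el x hP hQ (by omega) (by omega)
  have r2 : Rep x (el x P Q 0) P (Q+1) 0 := by
    have h3 : el x P Q 0 = el x P Q 0 * el x P (Q+1) 0 := by
      conv_lhs => rw [h]
      conv_rhs => rw [h]
      exact Rep.eq (rep_el x hP (by omega) (by omega) (by omega))
        (((rep_el x hP (by omega) (by omega) (by omega)).mul
          (rep_el x hP (by omega) (by omega) (by omega))).cast (by omega) (by omega) (by omega))
    have h4 := r1.mul (rep_el x hP (show 0 ≤ Q+1 by omega) (show -P ≤ 0 by omega) (by omega))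
    rw [← h3] at h4
    exact h4.cast (by omega) (by omega) (by omega)
  generalize el x P Q 0 = f at r1 r2
  -- conjugate by g of displacement q - Q
  have key : ∀ c : M, ∀ a b d : ℤ, Rep x c a b d → a ≤ p → b ≤ q → d = q - Q →
      el x p q 0 = el x p (q+1) 0 := by
    intro c a b d hc ha hb hd
    have hc1 := hc.1
    have hc2 := hc.2.1
    have hc3 := hc.2.2.1
    have hc4 := hc.2.2.2.1
    have hr := rep_el x hp hq (show -p ≤ 0 by omega) (by omega)
    have s1 := hr.mul ((hc.mul r1).mul hc.inv)
    have s2 := hr.mul ((hc.mul r2).mul hc.inv)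
    have t1 : Rep x _ p q 0 := s1.cast (by omega) (by omega) (by omega)
    have t2 : Rep x _ p (q+1) 0 := s2.cast (by omega) (by omega) (by omega)
    exact t1.2.2.2.2.symm.trans t2.2.2.2.2
  rcases le_total q Q with h | h
  · exact key _ (Q - q) 0 (q - Q) (rep_el x (by omega) (by omega) (by omega) (by omega))
      (by omega) (by omega) rfl
  · exact key _ 0 (q - Q) (q - Q) (rep_el x (by omega) (by omega) (by omega) (by omega))
      (by omega) (by omega) rfl

end IMon

namespace IMon
variable {M : Type*} [IMon M]

theorem InvGen_of_sub {X : Set M} {U : Set M} (hU : IsInvSub U) (hX : X ⊆ U) {s : M}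
    (h : InvGen X s) : s ∈ U := by
  induction h with
  | base h => exact hX h
  | mul _ _ a b => exact hU.1 _ a _ b
  | inv _ a => exact hU.2 _ a

theorem invGen_sub (X : Set M) : IsInvSub {s | InvGen X s} :=
  ⟨fun _ ha _ hb => InvGen.mul ha hb, fun _ ha => InvGen.inv ha⟩

theorem invGen_trans {X Y : Set M} (h : ∀ y ∈ Y, InvGen X y) {s : M} (hs : InvGen Y s) :
    InvGen X s := InvGen_of_sub (invGen_sub X) h hs

/-- Generating a larger element from a smaller one and `w`. -/
theorem gen {x w ti tj : M} {pw qw K pi qi ki : ℤ} (hw : Rep x w pw qw K) (hK : 0 < K)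
    (hi : Rep x ti pi qi ki) (hp : pw ≤ pi) (hq : qw ≤ qi) (c d d' : ℕ)
    (hcd : c ≤ d) (hj : Rep x tj (pi + d' * K) (qi + d * K) (ki + c * K)) :
    InvGen {w, ti} tj := by
  have gw : InvGen {w, ti} w := .base (by simp)
  have gi : InvGen {w, ti} ti := .base (by simp)
  have ge : InvGen {w, ti} (ti * ti⁻¹) := gi.mul gi.inv
  have hie := hi.idem
  have w1 := hw.1
  have w2 := hw.2.1
  have w3 := hw.2.2.1
  have w4 := hw.2.2.2.1
  have i1 := hi.1
  have i2 := hi.2.1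
  have i3 := hi.2.2.1
  have i4 := hi.2.2.2.1
  have A : ∀ d : ℕ, ∃ f, InvGen {w, ti} f ∧ ∃ p, pw ≤ p ∧ p ≤ pi ∧ Rep x f p (qi + d * K) 0 := by
    intro d
    induction d with
    | zero => exact ⟨_, ge, pi, hp, le_rfl, hie.cast rfl (by simp) rfl⟩
    | succ d ih =>
      obtain ⟨f, hf, p, h1, h2, hr⟩ := ih
      have : 0 ≤ (d:ℤ) * K := by positivity
      refine ⟨w * f * w⁻¹, (gw.mul hf).mul gw.inv, max pw (p - K), by omega, by omega,
        ((hw.mul hr).mul hw.inv).cast (by omega) ?_ (by omega)⟩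
      push_cast
      rw [add_mul]
      omega
  have B : ∀ d : ℕ, ∃ f, InvGen {w, ti} f ∧ ∃ q, 0 ≤ q ∧ q ≤ qi ∧ Rep x f (pi + d * K) q 0 := by
    intro d
    induction d with
    | zero => exact ⟨_, ge, qi, by omega, le_rfl, hie.cast (by simp) rfl rfl⟩
    | succ d ih =>
      obtain ⟨f, hf, q, h1, h2, hr⟩ := ih
      have : 0 ≤ (d:ℤ) * K := by positivity
      refine ⟨w⁻¹ * f * w, (gw.inv.mul hf).mul gw, max (qw - K) (q - K), by omega, by omega,
        ((hw.inv.mul hr).mul hw).cast ?_ (by omega) (by omega)⟩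
      push_cast
      rw [add_mul]
      omega
  have C : ∀ c : ℕ, ∃ f, InvGen {w, ti} f ∧ ∃ p, 0 ≤ p ∧ p ≤ pi ∧
      Rep x f p (qi + c * K) (ki + c * K) := by
    intro c
    induction c with
    | zero => exact ⟨_, gi, pi, by omega, le_rfl, hi.cast (by simp) (by simp) (by simp)⟩
    | succ d ih =>
      obtain ⟨f, hf, p, h1, h2, hr⟩ := ih
      have : 0 ≤ (d:ℤ) * K := by positivity
      refine ⟨w * f, gw.mul hf, max pw (p - K), by omega, by omega,
        (hw.mul hr).cast (by omega) ?_ ?_⟩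
      all_goals push_cast
      all_goals rw [add_mul]
      all_goals omega
  obtain ⟨f1, g1, p1, a1, b1, r1⟩ := A d
  obtain ⟨f2, g2, q2, a2, b2, r2⟩ := B d'
  obtain ⟨f3, g3, p3, a3, b3, r3⟩ := C c
  have hcd' : (c:ℤ) * K ≤ d * K := by
    have : (c:ℤ) ≤ d := by exact_mod_cast hcd
    exact mul_le_mul_of_nonneg_right this hK.le
  have : 0 ≤ (d':ℤ) * K := by positivity
  have : 0 ≤ (d:ℤ) * K := by positivity
  have : tj = f2 * f1 * f3 :=
    hj.eq (((r2.mul r1).mul r3).cast (by omega) (by omega) (by omega))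
  rw [this]
  exact (g2.mul g1).mul g3

def Bad (T : Set M) (t : ℕ → M) : Prop :=
  (∀ n, t n ∈ T) ∧ ∀ w ∈ T, ∃ m, ∀ j ≥ m, ∀ i < j, ¬ InvGen {w, t i} (t j)

theorem Bad.subseq {T : Set M} {t : ℕ → M} (h : Bad T t) (φ : ℕ → ℕ) (hφ : StrictMono φ) :
    Bad T (fun n => t (φ n)) := by
  refine ⟨fun n => h.1 _, fun w hw => ?_⟩
  obtain ⟨m, hm⟩ := h.2 w hw
  exact ⟨m, fun j hj i hi => hm _ (hj.trans (hφ.id_le j)) _ (hφ hi)⟩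

theorem bad_exists [Countable M] {T : Set M} (hT : IsInvSub T) (hn : ¬ InvFG T) :
    ∃ t, Bad T t := by
  classical
  have hne : T.Nonempty := by
    by_contra h
    rw [Set.not_nonempty_iff_eq_empty] at h
    apply hn
    refine ⟨∅, by simp, ?_⟩
    rw [h]
    symm
    rw [Set.eq_empty_iff_forall_notMem]
    intro s hs
    have := InvGen_of_sub (U := (∅ : Set M)) ⟨by simp, by simp⟩ (by simp) hs
    exact this
  obtain ⟨s, hs⟩ := (Set.to_countable T).exists_eq_range hne
  have hsT : ∀ n, s n ∈ T := fun n => hs ▸ Set.mem_range_self n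
  have hJ : ∀ m, ∃ n > m, ¬ InvGen {y | ∃ i < n, y = s i} (s n) := by
    intro m
    by_contra! hcon
    apply hn
    refine ⟨(Finset.range (m+1)).image s, ?_, ?_⟩
    · intro y hy
      simp only [Finset.coe_image, Set.mem_image] at hy
      obtain ⟨i, -, rfl⟩ := hy
      exact hsT i
    · have key : ∀ n, InvGen (↑((Finset.range (m+1)).image s) : Set M) (s n) := by
        intro n
        induction n using Nat.strong_induction_on with
        | _ n ih =>
          rcases le_or_gt n m with h | h
          · apply InvGen.base
            simp only [Finset.coe_image, Set.mem_image, Finset.coe_range, Set.mem_Iio]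
            exact ⟨n, by omega, rfl⟩
          · refine invGen_trans ?_ (hcon n h)
            rintro y ⟨i, hi, rfl⟩
            exact ih i hi
      apply Set.Subset.antisymm
      · intro y hy
        rw [hs] at hy
        obtain ⟨n, rfl⟩ := hy
        exact key n
      · intro y hy
        refine InvGen_of_sub hT ?_ hy
        intro z hz
        simp only [Finset.coe_image, Set.mem_image] at hz
        obtain ⟨i, -, rfl⟩ := hz
        exact hsT i
  obtain ⟨φ, hφ, hφ2⟩ := Filter.extraction_of_frequently_atTop
    (P := fun n => ¬ InvGen {y | ∃ i < n, y = s i} (s n)) (by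
      rw [Filter.frequently_atTop]
      intro m
      obtain ⟨n, h1, h2⟩ := hJ m
      exact ⟨n, h1.le, h2⟩)
  refine ⟨fun n => s (φ n), fun n => hsT _, fun w hw => ?_⟩
  rw [hs] at hw
  obtain ⟨m, rfl⟩ := hw
  refine ⟨m+1, fun j hj i hi hg => hφ2 j (invGen_trans ?_ hg)⟩
  rintro y (rfl | rfl)
  · exact .base ⟨m, lt_of_lt_of_le (show m < j by omega) (hφ.id_le j), rfl⟩
  · exact .base ⟨φ i, hφ hi, rfl⟩

theorem gen_seq {x : M} {T : Set M} {t : ℕ → M} (hb : Bad T t) {p k r : ℕ → ℕ}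
    (ht : ∀ n, Rep x (t n) (p n) (k n + r n) (k n)) (hp : Monotone p) (hk : Monotone k)
    (hr : Monotone r) {w : M} (hwT : w ∈ T) {pw qw K : ℤ} (hw : Rep x w pw qw K) (hK : 0 < K)
    (n0 : ℕ) (h1 : pw ≤ p n0) (h2 : qw ≤ k n0 + r n0) : False := by
  obtain ⟨m, hm⟩ := hb.2 w hwT
  obtain ⟨L, rfl⟩ := Int.eq_ofNat_of_zero_le hK.le
  have hL : 0 < L := by exact_mod_cast hK
  have : NeZero L := ⟨hL.ne'⟩
  have core : ∀ a b : ℕ, a < b → (p (m + n0 + a) : ZMod L) = p (m + n0 + b) →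
      (k (m + n0 + a) : ZMod L) = k (m + n0 + b) →
      (r (m + n0 + a) : ZMod L) = r (m + n0 + b) → False := by
    intro a b hab e1 e2 e3
    have mono : m + n0 + a ≤ m + n0 + b := by omega
    have mono0 : n0 ≤ m + n0 + a := by omega
    have z1 := hp mono
    have z2 := hk mono
    have z3 := hr mono
    have y1 := hp mono0
    have y2 := hk mono0
    have y3 := hr mono0
    have gh : ∀ u v : ℕ, u ≤ v → (u : ZMod L) = v → ∃ d : ℕ, v = u + d * L := by
      intro u v huv h
      rw [ZMod.natCast_eq_natCast_iff] at h
      obtain ⟨d, hd⟩ := (Nat.modEq_iff_dvd' huv).1 h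
      exact ⟨d, by rw [mul_comm, ← hd]; omega⟩
    obtain ⟨d', f1⟩ := gh _ _ z1 e1
    obtain ⟨c, f2⟩ := gh _ _ z2 e2
    obtain ⟨d, f3⟩ := gh _ _ z3 e3
    refine hm (m + n0 + b) (by omega) (m + n0 + a) (by omega)
      (gen hw hK (ht _) (by omega) (by omega) c (c + d) d' (by omega)
        ((ht _).cast ?_ ?_ ?_))
    · rw [f1]; push_cast; ring
    · rw [f2, f3]; push_cast; ring
    · rw [f2]; push_cast; ring
  obtain ⟨a, b, hab, h⟩ := Finite.exists_ne_map_eq_of_infinite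
    (fun n : ℕ => ((p (m + n0 + n) : ZMod L), (k (m + n0 + n) : ZMod L), (r (m + n0 + n) : ZMod L)))
  simp only [Prod.mk.injEq] at h
  rcases lt_or_gt_of_ne hab with hl | hl
  · exact core a b hl h.1 h.2.1 h.2.2
  · exact core b a hl h.1.symm h.2.1.symm h.2.2.symm

/-- Right-going elements in a finitely generated inverse subsemigroup. -/
theorem fg_right {x : M} (hx : ∀ s : M, ∃ p q k, Rep x s p q k) {U : Set M} (hU : IsInvSub U)
    (hfg : InvFG U) : ∃ N : ℤ, 0 ≤ N ∧ ∀ s ∈ U, ∃ P Q κ, Rep x s P Q κ ∧ (Q ≤ N ∨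
      ∃ u ∈ U, ∃ pu qu ku, Rep x u pu qu ku ∧ pu ≤ P ∧ qu ≤ N ∧ 1 ≤ ku ∧ ku ≤ N) := by
  classical
  obtain ⟨X, hXU, hXe⟩ := hfg
  choose fp fq fk hf using hx
  let Y : Finset M := X ∪ X.image (fun a => a⁻¹)
  have hYU : ∀ y ∈ Y, y ∈ U := by
    intro y hy
    simp only [Y, Finset.mem_union, Finset.mem_image] at hy
    rcases hy with h | ⟨a, h, rfl⟩
    · exact hXU h
    · exact hU.2 _ (hXU h)
  have hYinv : ∀ y ∈ Y, y⁻¹ ∈ Y := by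
    intro y hy
    simp only [Y, Finset.mem_union, Finset.mem_image] at hy ⊢
    rcases hy with h | ⟨a, h, rfl⟩
    · exact Or.inr ⟨y, h, rfl⟩
    · rw [inv_invol']; exact Or.inl h
  obtain ⟨N, hN⟩ : ∃ N : ℤ, ∀ y ∈ insert 1 Y, fq y ≤ N := by
    obtain ⟨N, hN⟩ := ((insert 1 Y).image fq).bddAbove
    exact ⟨N, fun y hy => hN (Finset.mem_coe.2 (Finset.mem_image_of_mem fq hy))⟩
  have hN0 : 0 ≤ N := le_trans (hf 1).2.1 (hN 1 (by simp))
  refine ⟨N, hN0, ?_⟩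
  have hcl : ∀ s, InvGen (↑X : Set M) s → s ∈ Submonoid.closure (Y : Set M) ∧
      s⁻¹ ∈ Submonoid.closure (Y : Set M) := by
    intro s hs
    induction hs with
    | base h =>
      have : ∀ z ∈ X, z ∈ Y := fun z hz => by simp [Y, hz]
      exact ⟨Submonoid.subset_closure (this _ h),
        Submonoid.subset_closure (hYinv _ (this _ h))⟩
    | mul _ _ ih1 ih2 =>
      rw [mul_inv_rev']
      exact ⟨mul_mem ih1.1 ih2.1, mul_mem ih2.2 ih1.2⟩
    | inv _ ih => rw [inv_invol']; exact ⟨ih.2, ih.1⟩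
  have main : ∀ s, s ∈ Submonoid.closure (Y : Set M) → (s = 1 ∨ s ∈ U) ∧
      ∃ P Q κ, Rep x s P Q κ ∧ ((κ ≤ 0 ∧ Q ≤ N) ∨
      ∃ u ∈ U, ∃ pu qu ku, Rep x u pu qu ku ∧ pu ≤ P ∧ qu ≤ N ∧ 1 ≤ ku ∧ ku ≤ N) := by
    intro s hs
    induction hs using Submonoid.closure_induction_right with
    | one =>
      exact ⟨Or.inl rfl, 0, 0, 0, ⟨le_rfl, le_rfl, by simp, le_rfl, (el_one x).symm⟩,
        Or.inl ⟨le_rfl, hN0⟩⟩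
    | mul_right s _ z hz ih =>
      obtain ⟨hsU, P, Q, κ, hr, halt⟩ := ih
      have hzU : z ∈ U := hYU z hz
      have hszU : s * z ∈ U := by
        rcases hsU with rfl | h
        · simpa using hzU
        · exact hU.1 _ h _ hzU
      refine ⟨Or.inr hszU, ?_⟩
      have hzr := hf z
      have hzN := hN z (by simp at hz ⊢; exact Or.inr hz)
      have hz4 := hzr.2.2.2.1
      refine ⟨_, _, _, hr.mul hzr, ?_⟩
      rcases halt with ⟨h1, h2⟩ | ⟨u, hu, pu, qu, ku, h1, h2, h3⟩
      · rcases le_or_gt (κ + fk z) 0 with h | h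
        · exact Or.inl ⟨h, by omega⟩
        · exact Or.inr ⟨_, hszU, _, _, _, hr.mul hzr, le_rfl, by omega, by omega, by omega⟩
      · exact Or.inr ⟨u, hu, pu, qu, ku, h1, by omega, h3⟩
  intro s hs
  rw [hXe] at hs
  obtain ⟨-, P, Q, κ, hr, halt⟩ := main s (hcl s hs).1
  exact ⟨P, Q, κ, hr, halt.imp (fun h => h.2) id⟩

theorem mem_pow {x : M} {U : Set M} (hU : IsInvSub U) {s u : M} {p q pu qu ku : ℤ} {b : ℕ}
    (hs : s ∈ U) (hu : u ∈ U) (hrs : Rep x s p q 0) (hru : Rep x u pu qu ku) (hk : 0 ≤ ku)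
    (hp : pu ≤ p) (hq : qu + b * ku ≤ q) : el x p q (b * ku) ∈ U := by
  induction b with
  | zero => 
    have := hrs.2.2.2.2
    simpa [← this] using hs
  | succ b ih =>
    push_cast at hq
    rw [add_mul] at hq
    have : 0 ≤ (b:ℤ) * ku := by positivity
    have h1 := hU.1 _ (ih (by omega)) _ hu
    have a1 := hrs.1
    have a2 := hrs.2.1
    have a3 := hru.2.1
    have h2 := (rep_el x (k := b * ku) a1 a2 (by omega) (by omega)).mul hru
    have h3 := h2.2.2.2.2
    rw [h3] at h1
    convert h1 using 1
    push_cast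
    rw [add_mul]
    congr 1 <;> omega

theorem idem_case {x : M} (hx : ∀ s : M, ∃ p q k, Rep x s p q k) {U V : Set M}
    (hU : IsInvSub U) (hV : IsInvSub V) (fU : InvFG U) (fV : InvFG V) {t : ℕ → M}
    (hb : Bad (U ∩ V) t) {p q : ℕ → ℕ} (ht : ∀ n, Rep x (t n) (p n) (q n) 0)
    (hmin : ∀ n, ∀ p' q' : ℕ, Rep x (t n) p' q' 0 → p n + q n ≤ p' + q')
    (hp : Monotone p) (hq : Monotone q) (hunb : ∀ B, ∃ n, B < q n) : False := by
  obtain ⟨N1, hN1, H1⟩ := fg_right hx hU fU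
  obtain ⟨N2, hN2, H2⟩ := fg_right hx hV fV
  -- no element has a representation with small right part
  have nocol : ∀ n P Q κ, Rep x (t n) P Q κ → (q n : ℤ) ≤ Q := by
    intro n P Q κ hr
    by_contra! hlt
    have e1 : t n * (t n)⁻¹ = t n :=
      ((ht n).idem).eq (ht n)
    have hr' := hr.idem
    rw [e1] at hr'
    have a1 := hr'.1
    have a2 := hr'.2.1
    have s1 := (ht n).mul (ht n)
    have ee : t n * t n = t n := s1.eq ((ht n).cast (by omega) (by omega) (by omega))
    have s2 := hr'.mul (ht n)
    rw [ee] at s2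
    have s2' : Rep x (t n) (max P (p n)) (q n) 0 := s2.cast (by omega) (by omega) (by omega)
    have s4 : Rep x (t n) (max P (p n)) Q 0 := by
      refine ⟨by omega, by omega, by omega, by omega, ?_⟩
      have r1 := rep_el x (p := max P (p n)) (q := Q) (k := 0) (by omega) (by omega) (by omega)
        (by omega)
      have m1 := hr'.mul r1
      have m2 := s2'.mul r1
      have m2' : t n * el x (max P (p n)) Q 0 = t n :=
        m2.eq (s2'.cast (by omega) (by omega) (by omega))
      rw [m2'] at m1
      exact (m1.cast (p' := max P (p n)) (q' := Q) (k' := 0) (by omega) (by omega)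
        (by omega)).2.2.2.2
    have hcol := right_collapse (x := x) (P := max P (p n)) (Q := Q) (Q' := q n) (by omega)
      (by omega) hlt (s4.2.2.2.2.symm.trans s2'.2.2.2.2)
    obtain ⟨m, hm⟩ := hunb (max P (p n) + Q).toNat
    have hc := hcol (p m) ((q m - 1 : ℕ) : ℤ) (by omega) (by omega) (by omega)
    have hq1 : (((q m - 1 : ℕ) : ℤ) + 1) = q m := by omega
    rw [hq1, ← (ht m).2.2.2.2] at hc
    have := hmin m (p m) (q m - 1) ⟨by omega, by omega, by omega, by omega, hc.symm⟩
    omega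
  obtain ⟨n, hn⟩ := hunb (N1 + N2 + N2 * N1 + N1 * N2).toNat
  have hnn : 0 ≤ N2 * N1 := by positivity
  have hnn' : 0 ≤ N1 * N2 := by positivity
  have htU := (hb.1 n).1
  have htV := (hb.1 n).2
  have ext : ∀ P Q κ pu, Rep x (t n) P Q κ → 0 ≤ pu → pu ≤ P →
      Rep x (t n) (max (p n) pu) (q n) 0 := by
    intro P Q κ pu hr h0 hle
    have e1 : t n * (t n)⁻¹ = t n :=
      ((ht n).idem).eq (ht n)
    have hr' := hr.idem
    rw [e1] at hr'
    have a1 := hr'.1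
    have a2 := hr'.2.1
    have r1 := rep_el x (p := pu) (q := 0) (k := 0) (by omega) (by omega) (by omega) (by omega)
    have m1 := hr'.mul r1
    have m1' : t n * el x pu 0 0 = t n := m1.eq (hr'.cast (by omega) (by omega) (by omega))
    have m2 := (ht n).mul r1
    rw [m1'] at m2
    exact m2.cast (by omega) (by omega) (by omega)
  obtain ⟨P, Q, κ, hr, hQ | ⟨u, hu, pu, qu, ku, ru, hpu, hqu, hku1, hku2⟩⟩ := H1 _ htU
  · have := nocol n _ _ _ hr; omega
  obtain ⟨P', Q', κ', hr', hQ' | ⟨v, hv, pv, qv, kv, rv, hpv, hqv, hkv1, hkv2⟩⟩ := H2 _ htV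
  · have := nocol n _ _ _ hr'; omega
  have x1 := ext _ _ _ _ hr ru.1 hpu
  have x2 := ext _ _ _ _ hr' rv.1 hpv
  have hmul : kv * ku ≤ N2 * N1 := mul_le_mul hkv2 hku2 (by omega) (by omega)
  have hmul' : ku * kv ≤ N1 * N2 := mul_le_mul hku2 hkv2 (by omega) (by omega)
  obtain ⟨a, rfl⟩ := Int.eq_ofNat_of_zero_le (show 0 ≤ ku by omega)
  obtain ⟨b, rfl⟩ := Int.eq_ofNat_of_zero_le (show 0 ≤ kv by omega)
  have y1 := mem_pow hU (b := b) htU hu x1 ru (by omega) (by omega) (by omega)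
  have y2 := mem_pow hV (b := a) htV hv x2 rv (by omega) (by omega) (by omega)
  have fin : ∀ p' K : ℤ, Rep x (t n) p' (q n) 0 → 0 ≤ K → K ≤ q n →
      el x p' (q n) K = el x (p n) (q n) K := by
    intro p' K h hK hK2
    have a := h.2.2.2.2
    have b := (ht n).2.2.2.2
    have hg0 : g x 0 = 1 := by simp [g]
    unfold el at a b ⊢
    rw [hg0, mul_one] at a b
    rw [← a, ← b]
  have hK0 : 0 < (b:ℤ) * a := by
    have : 0 < (a:ℤ) := by omega
    have : 0 < (b:ℤ) := by omega
    positivity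
  rw [fin _ _ x1 (by omega) (by omega)] at y1
  rw [mul_comm, fin _ _ x2 (by omega) (by omega)] at y2
  exact gen_seq (x := x) (k := fun _ => 0) (r := q) hb
    (fun n => (ht n).cast (by simp) (by simp) (by simp))
    hp monotone_const hq (w := el x (p n) (q n) (b * a)) ⟨y1, y2⟩
    (rep_el x (by omega) (by omega) (by omega) (by omega)) hK0 n le_rfl (by simp)

theorem howson {x : M} (hx : ∀ s : M, ∃ p q k, Rep x s p q k) : Howson M := by
  intro U V hU hV fU fV
  by_contra hcon
  have hT : IsInvSub (U ∩ V) :=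
    ⟨fun a ha b hb => ⟨hU.1 _ ha.1 _ hb.1, hV.1 _ ha.2 _ hb.2⟩,
     fun a ha => ⟨hU.2 _ ha.1, hV.2 _ ha.2⟩⟩
  have : Countable M := by
    have : Function.Surjective (fun z : ℤ × ℤ × ℤ => el x z.1 z.2.1 z.2.2) := by
      intro s
      obtain ⟨p, q, k, h⟩ := hx s
      exact ⟨(p, q, k), h.2.2.2.2.symm⟩
    exact this.countable
  obtain ⟨t0, hb0⟩ := bad_exists hT hcon
  -- normalize to nonnegative displacement
  have hnorm : ∀ n, ∃ s, (s = t0 n ∨ s = (t0 n)⁻¹) ∧ ∃ z : ℕ × ℕ × ℕ,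
      Rep x s z.1 (z.2.1 + z.2.2) z.2.1 := by
    intro n
    obtain ⟨p, q, k, h⟩ := hx (t0 n)
    have h1 := h.1
    have h2 := h.2.1
    have h3 := h.2.2.1
    have h4 := h.2.2.2.1
    rcases le_total 0 k with hk | hk
    · exact ⟨_, Or.inl rfl, (p.toNat, k.toNat, (q-k).toNat),
        h.cast (by simp; omega) (by simp; omega) (by simp; omega)⟩
    · exact ⟨_, Or.inr rfl, ((p+k).toNat, (-k).toNat, q.toNat),
        h.inv.cast (by simp; omega) (by simp; omega) (by simp; omega)⟩
  choose t1 ht1 z hz using hnorm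
  have hb1 : Bad (U ∩ V) t1 := by
    refine ⟨fun n => ?_, fun w hw => ?_⟩
    · rcases ht1 n with h | h
      · rw [h]; exact hb0.1 n
      · rw [h]; exact hT.2 _ (hb0.1 n)
    · obtain ⟨m, hm⟩ := hb0.2 w hw
      refine ⟨m, fun j hj i hi hg => hm j hj i hi ?_⟩
      have h2 : InvGen {w, t0 i} (t1 j) := by
        refine invGen_trans ?_ hg
        rintro y (rfl | rfl)
        · exact .base (by simp)
        · rcases ht1 i with h | h
          · rw [h]; exact .base (by simp)
          · rw [h]; exact .inv (.base (by simp))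
      rcases ht1 j with h | h
      · rwa [h] at h2
      · rw [h] at h2
        have := h2.inv
        rwa [inv_invol'] at this
  obtain ⟨φ, hφ⟩ := (wellQuasiOrdered_le (α := ℕ × ℕ × ℕ)).exists_monotone_subseq z
  have hb2 := hb1.subseq φ φ.strictMono
  by_cases hpos : ∃ n, 0 < (z (φ n)).2.1
  · obtain ⟨n, hn⟩ := hpos
    exact gen_seq (x := x) hb2 (p := fun n => (z (φ n)).1) (k := fun n => (z (φ n)).2.1)
      (r := fun n => (z (φ n)).2.2) (fun n => hz _) (fun a b h => (hφ a b h).1)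
      (fun a b h => (hφ a b h).2.1) (fun a b h => (hφ a b h).2.2) (hb2.1 n) (hz (φ n))
      (by exact_mod_cast hn) n le_rfl le_rfl
  push Not at hpos
  -- idempotents: choose minimal representations
  have hmin : ∀ n, ∃ y : ℕ × ℕ, Rep x (t1 (φ n)) y.1 y.2 0 ∧
      ∀ p' q' : ℕ, Rep x (t1 (φ n)) p' q' 0 → y.1 + y.2 ≤ p' + q' := by
    intro n
    have hne : {y : ℕ × ℕ | Rep x (t1 (φ n)) y.1 y.2 0}.Nonempty := by
      have h0 := hpos n
      refine ⟨((z (φ n)).1, (z (φ n)).2.2), (hz (φ n)).cast rfl ?_ ?_⟩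
      · simp; omega
      · omega
    refine ⟨Function.argminOn (fun y : ℕ × ℕ => y.1 + y.2) _ hne,
      Function.argminOn_mem (fun y : ℕ × ℕ => y.1 + y.2) _ hne, fun p' q' h => ?_⟩
    exact Function.argminOn_le (fun y : ℕ × ℕ => y.1 + y.2)
      {y : ℕ × ℕ | Rep x (t1 (φ n)) y.1 y.2 0} (a := (p', q')) h
  choose y hy1 hy2 using hmin
  obtain ⟨ψ, hψ⟩ := (wellQuasiOrdered_le (α := ℕ × ℕ)).exists_monotone_subseq y
  have hb3 := hb2.subseq ψ ψ.strictMono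
  have m1 : Monotone (fun n => (y (ψ n)).1) := fun a b h => (hψ a b h).1
  have m2 : Monotone (fun n => (y (ψ n)).2) := fun a b h => (hψ a b h).2
  by_cases hu2 : ∀ B, ∃ n, B < (y (ψ n)).2
  · exact idem_case hx hU hV fU fV hb3 (p := fun n => (y (ψ n)).1) (q := fun n => (y (ψ n)).2)
      (fun n => hy1 _) (fun n => hy2 _) m1 m2 hu2
  by_cases hu1 : ∀ B, ∃ n, B < (y (ψ n)).1
  · refine idem_case (x := x⁻¹) ?_ hU hV fU fV hb3 (q := fun n => (y (ψ n)).1)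
      (p := fun n => (y (ψ n)).2)
      (fun n => (hy1 _).swap) (fun n p' q' h => ?_) m2 m1 hu1
    · intro s
      obtain ⟨p, q, k, h⟩ := hx s
      exact ⟨_, _, _, h.swap⟩
    · have h' := h.swap
      rw [inv_invol'] at h'
      have := hy2 (ψ n) q' p' h'
      omega
  push Not at hu1 hu2
  obtain ⟨B1, hB1⟩ := hu1
  obtain ⟨B2, hB2⟩ := hu2
  obtain ⟨m, hm⟩ := hb3.2 _ (hb3.1 0)
  obtain ⟨a, b, hab, h⟩ := Finite.exists_ne_map_eq_of_infinite
    (fun n : ℕ => ((⟨(y (ψ (m + n))).1, Nat.lt_succ_of_le (hB1 _)⟩ : Fin (B1+1)),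
      (⟨(y (ψ (m + n))).2, Nat.lt_succ_of_le (hB2 _)⟩ : Fin (B2+1))))
  simp only [Prod.mk.injEq, Fin.mk.injEq] at h
  have heq : t1 (φ (ψ (m + a))) = t1 (φ (ψ (m + b))) := by
    have h1 := hy1 (ψ (m + a))
    rw [h.1, h.2] at h1
    exact h1.eq (hy1 (ψ (m + b)))
  rcases lt_or_gt_of_ne hab with hl | hl
  · exact hm (m + b) (by omega) (m + a) (by omega) (.base (by simp [heq]))
  · exact hm (m + a) (by omega) (m + b) (by omega) (.base (by simp [heq]))

end IMon

noncomputable instance withOneIMon {S : Type*} [InverseSemigroup S] : IMon (WithOne S) where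
  mul_inv_mul' a := by
    induction a with
    | one => simp
    | coe a =>
      rw [← WithOne.coe_inv, ← WithOne.coe_mul, ← WithOne.coe_mul, InverseSemigroup.mul_inv_mul]
  inv_invol' a := by
    induction a with
    | one => simp
    | coe a => rw [← WithOne.coe_inv, ← WithOne.coe_inv, InverseSemigroup.inv_invol]
  idem_comm' a b := by
    induction a with
    | one => simp
    | coe a =>
      induction b with
      | one => simp
      | coe b =>
        simp only [← WithOne.coe_inv, ← WithOne.coe_mul]
        rw [InverseSemigroup.idem_comm]

theorem invGen_coe {S : Type*} [InverseSemigroup S] {X : Set S} {s : S} (h : InvGen X s) :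
    InvGen ((fun a : S => (a : WithOne S)) '' X) (s : WithOne S) := by
  induction h with
  | base h => exact .base ⟨_, h, rfl⟩
  | mul _ _ a b => rw [WithOne.coe_mul]; exact .mul a b
  | inv _ a => rw [WithOne.coe_inv]; exact .inv a

theorem invGen_of_coe {S : Type*} [InverseSemigroup S] {X : Set S} {z : WithOne S}
    (h : InvGen ((fun a : S => (a : WithOne S)) '' X) z) :
    ∃ s : S, z = s ∧ InvGen X s := by
  induction h with
  | base h => obtain ⟨s, hs, rfl⟩ := h; exact ⟨s, rfl, .base hs⟩
  | mul _ _ a b =>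
    obtain ⟨s, rfl, hs⟩ := a
    obtain ⟨t, rfl, ht⟩ := b
    exact ⟨s * t, (WithOne.coe_mul s t).symm, .mul hs ht⟩
  | inv _ a =>
    obtain ⟨s, rfl, hs⟩ := a
    exact ⟨s⁻¹, (WithOne.coe_inv s).symm, .inv hs⟩

theorem invFG_coe {S : Type*} [InverseSemigroup S] {T : Set S} :
    InvFG T ↔ InvFG ((fun a : S => (a : WithOne S)) '' T) := by
  classical
  constructor
  · rintro ⟨X, hX, hT⟩
    refine ⟨X.image (fun a : S => (a : WithOne S)), ?_, ?_⟩
    · rw [Finset.coe_image]; exact Set.image_mono hX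
    · rw [Finset.coe_image]
      ext z
      constructor
      · rintro ⟨s, hs, rfl⟩
        rw [hT] at hs
        exact invGen_coe hs
      · intro hz
        obtain ⟨s, rfl, hs⟩ := invGen_of_coe hz
        refine ⟨s, ?_, rfl⟩
        rw [hT]; exact hs
  · rintro ⟨X, hX, hT⟩
    obtain ⟨Y, hY, rfl⟩ := Finset.subset_set_image_iff.1 hX
    rw [Finset.coe_image] at hT
    refine ⟨Y, hY, ?_⟩
    ext s
    have hc := Set.ext_iff.1 hT (s : WithOne S)
    constructor
    · intro hs
      obtain ⟨s', h1, h2⟩ := invGen_of_coe (hc.1 ⟨s, hs, rfl⟩)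
      rw [WithOne.coe_inj] at h1
      rw [h1]; exact h2
    · intro hs
      obtain ⟨s', h1, h2⟩ := hc.2 (invGen_coe hs)
      rw [WithOne.coe_inj] at h2
      rw [← h2]; exact h1

theorem isInvSub_coe {S : Type*} [InverseSemigroup S] {T : Set S} (hT : IsInvSub T) :
    IsInvSub ((fun a : S => (a : WithOne S)) '' T) := by
  constructor
  · rintro _ ⟨a, ha, rfl⟩ _ ⟨b, hb, rfl⟩
    exact ⟨a * b, hT.1 _ ha _ hb, WithOne.coe_mul _ _⟩
  · rintro _ ⟨a, ha, rfl⟩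
    exact ⟨a⁻¹, hT.2 _ ha, WithOne.coe_inv _⟩

theorem stmt_12 {S : Type*} [InverseSemigroup S] (x : S)
    (hgen : ∀ s : S, InvGen ({x} : Set S) s) : Howson S := by
  have hx : ∀ s : WithOne S, ∃ p q k, IMon.Rep (x : WithOne S) s p q k := by
    intro s
    induction s with
    | one => exact ⟨0, 0, 0, le_rfl, le_rfl, by simp, le_rfl, (IMon.el_one _).symm⟩
    | coe s =>
      apply IMon.exists_rep
      have := invGen_coe (hgen s)
      rwa [Set.image_singleton] at this
  intro U V hU hV fU fV
  have h := IMon.howson hx _ _ (isInvSub_coe hU) (isInvSub_coe hV) (invFG_coe.1 fU)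
    (invFG_coe.1 fV)
  rw [← Set.image_inter WithOne.coe_injective] at h
  exact invFG_coe.2 h
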